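/- Let Q : Fin c → Matrix (Fin n) (Fin n) ℂ be a linearly independent family of matrices and f : Fin c → Fin c → Fin c → ℂ structure constants satisfying, for all α, β, the commutation relations Q β * Q α − Q α * Q β = Σ_γ f γ β α • Q γ. Fix α, and suppose there exist β, γ with f γ β α ≠ 0. Then the matrix H = Σ_β (Q β ⊗ₖ Q β) does not commute with Q α ⊗ₖ I: the commutator [H, Q α ⊗ₖ I] is nonzero. -/

import Mathlib

open Matrix
open scoped Kronecker

/-- If `∑ i, A i ⊗ₖ B i = 0` and the second factors are linearly independent, then every first
factor vanishes. -/
theorem LinearIndependent.eq_zero_of_sum_kronecker_eq_zero {R ι l m p q : Type*} [CommSemiring R]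
    [Fintype ι] {A : ι → Matrix l m R} {B : ι → Matrix p q R} (hB : LinearIndependent R B)
    (h : ∑ i, A i ⊗ₖ B i = 0) (i : ι) : A i = 0 := by
  ext a b
  refine Fintype.linearIndependent_iffₛ.mp hB (fun i => A i a b) 0 ?_ i
  ext x y
  simpa [Matrix.sum_apply] using congr_fun₂ h (a, x) (b, y)

theorem Matrix.sub_kronecker {R l m p q : Type*} [NonUnitalNonAssocRing R]
    (A₁ A₂ : Matrix l m R) (B : Matrix p q R) :
    (A₁ - A₂) ⊗ₖ B = A₁ ⊗ₖ B - A₂ ⊗ₖ B := by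
  ext
  simp [sub_mul]

/-- Paper's Proposition 3: if the family `Q` is linearly independent and some
structure constant `f γ β α` is nonzero, then the two-body Hamiltonian
`H = Σ_β Q β ⊗ Q β` does not commute with the local charge `Q α ⊗ I`. -/
theorem H_transports_local_charge
    (n c : ℕ)
    (Q : Fin c → Matrix (Fin n) (Fin n) ℂ)
    (hQ : LinearIndependent ℂ Q)
    (f : Fin c → Fin c → Fin c → ℂ)
    (hf : ∀ α β, Q β * Q α - Q α * Q β = ∑ γ, f γ β α • Q γ)
    (α : Fin c)
    (hne : ∃ β γ, f γ β α ≠ 0) :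
    (∑ β, Q β ⊗ₖ Q β) * (Q α ⊗ₖ (1 : Matrix (Fin n) (Fin n) ℂ))
      - (Q α ⊗ₖ (1 : Matrix (Fin n) (Fin n) ℂ)) * (∑ β, Q β ⊗ₖ Q β) ≠ 0 := by
  obtain ⟨β, γ, hβγ⟩ := hne
  intro h
  simp only [Finset.sum_mul, Finset.mul_sum, ← mul_kronecker_mul, mul_one, one_mul,
    ← Finset.sum_sub_distrib, ← sub_kronecker] at h
  have hcomm := hQ.eq_zero_of_sum_kronecker_eq_zero h β
  rw [hf α β] at hcomm
  exact hβγ (Fintype.linearIndependent_iff.mp hQ _ hcomm γ)
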